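/- Let K : ℝ^d \ {0} → ℝ be of order ζ ∈ (-|s|, 0), let ρ : ℝ^d → ℝ be smooth, compactly supported with ∫ρ = 1, and set ρ_ε(y) = ε^{-|s|} ρ(S_s^ε y) and K_ε = K * ρ_ε. Then for every multiindex k there is a constant C such that |D^k K_ε(x)| ≤ C (‖x‖_s + ε)^{ζ - |k|_s} ⦀K⦀_{ζ;|k|_s}, uniformly over ε ∈ (0,1] and x ∈ ℝ^d. -/

import Mathlib

open MeasureTheory

/-- The scaled norm `‖x‖_s = ∑_i |x_i|^{1/s_i}` on `ℝ^d`. -/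
noncomputable def sNorm {d : ℕ} (s : Fin d → ℕ) (x : Fin d → ℝ) : ℝ :=
  ∑ i, |x i| ^ ((s i : ℝ)⁻¹)

/-- The scaled degree `|k|_s = ∑ s_i k_i` of a multiindex, encoded as a list of directions. -/
def sdeg {d : ℕ} (s : Fin d → ℕ) (ℓ : List (Fin d)) : ℕ := (ℓ.map s).sum

/-- Iterated partial derivative `D^ℓ f` along the list of coordinate directions `ℓ`. -/
noncomputable def mderiv {d : ℕ} : List (Fin d) → ((Fin d → ℝ) → ℝ) → (Fin d → ℝ) → ℝ
  | [], f => f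
  | i :: ℓ, f => fun x => fderiv ℝ (mderiv ℓ f) x (Pi.single i 1)

open scoped Topology in
lemma mderiv_congr {d : ℕ} (l : List (Fin d)) {f g : (Fin d → ℝ) → ℝ} {x : Fin d → ℝ}
    (h : f =ᶠ[𝓝 x] g) : mderiv l f =ᶠ[𝓝 x] mderiv l g := by
  induction l with
  | nil => exact h
  | cons i l ih =>
    filter_upwards [ih.fderiv (𝕜 := ℝ)] with y hy
    simp only [mderiv, hy]

lemma mderiv_contDiff {d : ℕ} (l : List (Fin d)) {f : (Fin d → ℝ) → ℝ}
    (h : ContDiff ℝ (⊤ : ℕ∞) f) : ContDiff ℝ (⊤ : ℕ∞) (mderiv l f) := by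
  induction l with
  | nil => exact h
  | cons i l ih =>
    have := ih.fderiv_right (m := ((⊤ : ℕ∞) : WithTop ℕ∞)) (by simp)
    exact this.clm_apply contDiff_const

lemma mderiv_tsupport {d : ℕ} (l : List (Fin d)) (f : (Fin d → ℝ) → ℝ) :
    tsupport (mderiv l f) ⊆ tsupport f := by
  induction l with
  | nil => exact subset_rfl
  | cons i l ih =>
    refine subset_trans ?_ ih
    refine subset_trans ?_ (tsupport_fderiv_subset ℝ)
    refine closure_mono ?_
    intro y hy
    simp only [mderiv, Function.mem_support] at hy ⊢
    intro h0
    simp [h0] at hy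

lemma mderiv_compactSupport {d : ℕ} (l : List (Fin d)) {f : (Fin d → ℝ) → ℝ}
    (h : HasCompactSupport f) : HasCompactSupport (mderiv l f) :=
  h.of_isClosed_subset (isClosed_tsupport _) (mderiv_tsupport l f)

lemma mderiv_scale {d : ℕ} (l : List (Fin d)) (f : (Fin d → ℝ) → ℝ) (c : Fin d → ℝ)
    (hc : ∀ i, c i ≠ 0) :
    mderiv l (fun z => f (fun i => c i * z i)) =
      fun z => (l.map c).prod * mderiv l f (fun i => c i * z i) := by
  induction l with
  | nil => simp [mderiv]
  | cons i l ih =>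
    funext z
    let e : (Fin d → ℝ) ≃L[ℝ] (Fin d → ℝ) := ContinuousLinearEquiv.piCongrRight
      (fun i => ContinuousLinearEquiv.unitsEquivAut ℝ (Units.mk0 (c i) (hc i)))
    have he : ∀ z, e z = fun i => c i * z i := by
      intro z; funext i; simp [e, mul_comm]
    have hcomp : (fun z => (l.map c).prod * mderiv l f (fun i => c i * z i)) =
        (fun z => (l.map c).prod • mderiv l f z) ∘ e := by
      funext z; simp [he]
    simp only [mderiv]
    rw [ih, hcomp, e.comp_right_fderiv]
    have h1 : fderiv ℝ (fun z => (l.map c).prod • mderiv l f z) (e z) =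
      (l.map c).prod • fderiv ℝ (mderiv l f) (e z) := by
      exact congrFun (fderiv_const_smul_field (𝕜 := ℝ) (f := mderiv l f) (l.map c).prod) (e z)
    rw [h1]
    have h2 : e (Pi.single i 1) = c i • Pi.single i (1:ℝ) := by
      rw [he]; funext j
      by_cases hj : j = i
      · subst hj; simp
      · simp [hj]
    simp [h2, he]
    ring

lemma mderiv_conv {d : ℕ} (l : List (Fin d)) {f g : (Fin d → ℝ) → ℝ}
    (hf : ContDiff ℝ (⊤ : ℕ∞) f) (hfc : HasCompactSupport f) (hg : LocallyIntegrable g) :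
    mderiv l (fun z => ∫ y, f (z - y) * g y) = fun z => ∫ y, mderiv l f (z - y) * g y := by
  induction l with
  | nil => rfl
  | cons i l ih =>
    funext z
    simp only [mderiv]
    rw [ih]
    have hs := mderiv_contDiff l hf
    have hcs := mderiv_compactSupport l hfc
    have key := hcs.hasFDerivAt_convolution_left (ContinuousLinearMap.mul ℝ ℝ)
      (μ := volume) (hs.of_le (by exact_mod_cast le_top)) hg z
    have e1 : convolution (mderiv l f) g (ContinuousLinearMap.mul ℝ ℝ) volume =
        fun z => ∫ y, mderiv l f (z - y) * g y := by
      funext z; rw [convolution_eq_swap]; rfl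
    rw [e1] at key
    rw [key.fderiv, convolution_eq_swap]
    have hint : Integrable (fun t => ((ContinuousLinearMap.precompL (Fin d → ℝ)
        (ContinuousLinearMap.mul ℝ ℝ)) (fderiv ℝ (mderiv l f) (z - t))) (g t)) := by
      have h3 : Continuous (fderiv ℝ (mderiv l f)) :=
        hs.continuous_fderiv (by simp)
      have := (hcs.fderiv ℝ).convolutionExists_left
        (ContinuousLinearMap.precompL (Fin d → ℝ) (ContinuousLinearMap.mul ℝ ℝ)) h3 hg z
      exact this.integrable_swap
    rw [ContinuousLinearMap.integral_apply hint]
    rfl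

lemma conv_comm {d : ℕ} (f g : (Fin d → ℝ) → ℝ) (z : Fin d → ℝ) :
    ∫ y, f (z - y) * g y = ∫ y, g (z - y) * f y := by
  rw [← integral_sub_left_eq_self _ volume z]
  simp [mul_comm]

lemma integral_scale {d : ℕ} (h : (Fin d → ℝ) → ℝ) (c : Fin d → ℝ) (hc : ∀ i, 0 < c i) :
    ∫ w, h w = (∏ i, c i) * ∫ y : Fin d → ℝ, h (fun i => c i * y i) := by
  have hp : 0 < ∏ i, c i := Finset.prod_pos fun i _ => hc i
  have hD : (Matrix.diagonal c).det ≠ 0 := by rw [Matrix.det_diagonal]; exact hp.ne'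
  let e : (Fin d → ℝ) ≃L[ℝ] (Fin d → ℝ) := ContinuousLinearEquiv.piCongrRight
      (fun i => ContinuousLinearEquiv.unitsEquivAut ℝ (Units.mk0 (c i) (hc i).ne'))
  have he : ∀ z, e z = fun i => c i * z i := by
    intro z; funext i; simp [e, mul_comm]
  have he' : (⇑(Matrix.toLin' (Matrix.diagonal c))) = e := by
    funext z; rw [he]; funext i
    simp [Matrix.mulVec_diagonal]
  have := Real.smul_map_diagonal_volume_pi hD
  conv_lhs => rw [← this]
  rw [integral_smul_measure, he', Matrix.det_diagonal, abs_of_pos hp,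
    ENNReal.toReal_ofReal hp.le, smul_eq_mul]
  congr 1
  have := e.toHomeomorph.measurableEmbedding.integral_map (μ := volume) h
  simp only [ContinuousLinearEquiv.coe_toHomeomorph, he] at this
  convert this using 3
lemma sNorm_nonneg {d : ℕ} (s : Fin d → ℕ) (x : Fin d → ℝ) : 0 ≤ sNorm s x :=
  Finset.sum_nonneg fun _ _ => Real.rpow_nonneg (abs_nonneg _) _

lemma le_sNorm {d : ℕ} (s : Fin d → ℕ) (x : Fin d → ℝ) (i : Fin d) :
    |x i| ^ ((s i : ℝ)⁻¹) ≤ sNorm s x :=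
  Finset.single_le_sum (f := fun i => |x i| ^ ((s i : ℝ)⁻¹))
    (fun _ _ => Real.rpow_nonneg (abs_nonneg _) _) (Finset.mem_univ i)

lemma sNorm_pos {d : ℕ} (s : Fin d → ℕ) {x : Fin d → ℝ} (hx : x ≠ 0) : 0 < sNorm s x := by
  obtain ⟨i, hi⟩ := Function.ne_iff.1 hx
  exact lt_of_lt_of_le (Real.rpow_pos_of_pos (abs_pos.2 hi) _) (le_sNorm s x i)

lemma sNorm_zero {d : ℕ} (s : Fin d → ℕ) (hs : ∀ i, 0 < s i) : sNorm s 0 = 0 := by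
  refine Finset.sum_eq_zero fun i _ => ?_
  have : (s i : ℝ)⁻¹ ≠ 0 := by have := hs i; positivity
  simp [Real.zero_rpow this]

lemma sNorm_continuous {d : ℕ} (s : Fin d → ℕ) : Continuous (sNorm s) := by
  refine continuous_finsetSum _ fun i _ => ?_
  exact (continuous_apply i).abs.rpow_const fun x => Or.inr (by positivity)

lemma sNorm_add_le {d : ℕ} (s : Fin d → ℕ) (hs : ∀ i, 0 < s i) (x y : Fin d → ℝ) :
    sNorm s (x + y) ≤ sNorm s x + sNorm s y := by
  unfold sNorm
  rw [← Finset.sum_add_distrib]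
  refine Finset.sum_le_sum fun i _ => ?_
  have h1 : (1 : ℝ) ≤ s i := by exact_mod_cast hs i
  calc |(x + y) i| ^ ((s i : ℝ)⁻¹) ≤ (|x i| + |y i|) ^ ((s i : ℝ)⁻¹) :=
        Real.rpow_le_rpow (abs_nonneg _) (abs_add_le _ _) (by positivity)
    _ ≤ _ := Real.rpow_add_le_add_rpow (abs_nonneg _) (abs_nonneg _) (by positivity)
        (inv_le_one_of_one_le₀ h1)

lemma sNorm_scale {d : ℕ} (s : Fin d → ℕ) (hs : ∀ i, 0 < s i) (ε : ℝ) (hε : 0 < ε)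
    (x : Fin d → ℝ) : sNorm s (fun i => ε ^ (s i) * x i) = ε * sNorm s x := by
  unfold sNorm
  rw [Finset.mul_sum]
  refine Finset.sum_congr rfl fun i _ => ?_
  rw [abs_mul, abs_of_pos (pow_pos hε _), Real.mul_rpow (by positivity) (by positivity),
    Real.pow_rpow_inv_natCast hε.le (hs i).ne']

lemma integrable_oneD (a M : ℝ) (ha : -1 < a) :
    Integrable (Set.indicator (Set.Icc (-M) M) (fun t : ℝ => |t| ^ a)) := by
  rw [integrable_indicator_iff measurableSet_Icc]
  rcases lt_or_ge M 0 with hM | hM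
  · rw [Set.Icc_eq_empty (by linarith)]; simp
  have h1 : IntegrableOn (fun t : ℝ => |t| ^ a) (Set.Icc 0 M) := by
    rw [integrableOn_Icc_iff_integrableOn_Ioc]
    have := (intervalIntegral.intervalIntegrable_rpow' (a := 0) (b := M) ha).1
    refine this.congr_fun ?_ measurableSet_Ioc
    intro t ht
    simp only [abs_of_pos ht.1]
  have h2 : IntegrableOn (fun t : ℝ => |t| ^ a) (Set.Icc (-M) 0) := by
    have := h1.comp_neg
    simpa using this
  refine (h2.union h1).mono_set ?_
  intro t ht
  rcases le_total t 0 with h | h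
  · exact Or.inl ⟨ht.1, h⟩
  · exact Or.inr ⟨h, ht.2⟩

lemma integrable_sNorm {d : ℕ} (s : Fin d → ℕ) (hs : ∀ i, 0 < s i) (ζ : ℝ)
    (hζ₁ : -(∑ i, (s i : ℝ)) < ζ) (hζ₂ : ζ < 0) (A : Set (Fin d → ℝ)) (M : ℝ)
    (hA : MeasurableSet A) (hAM : ∀ y ∈ A, ∀ i, |y i| ≤ M) :
    Integrable (Set.indicator A (fun y => sNorm s y ^ ζ)) := by
  set S := ∑ i, (s i : ℝ) with hS
  have hSpos : 0 < S := by linarith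
  have ha : -1 < ζ / S := by rw [lt_div_iff₀ hSpos]; linarith
  have hI : Integrable (fun y : Fin d → ℝ =>
      ∏ i, Set.indicator (Set.Icc (-M) M) (fun t : ℝ => |t| ^ (ζ / S)) (y i)) :=
    Integrable.fintype_prod (μ := fun _ => volume) (fun _ => integrable_oneD _ _ ha)
  refine hI.mono' ?_ ?_
  · refine (Measurable.indicator ?_ hA).aestronglyMeasurable
    exact (sNorm_continuous s).measurable.pow_const _
  · have hne : ∀ᵐ y : Fin d → ℝ, ∀ i, y i ≠ 0 := by
      rw [ae_all_iff]
      intro i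
      have : ∀ᵐ t : ℝ, t ≠ 0 := by
        rw [ae_iff]; simp
      exact (Measure.tendsto_eval_ae_ae (μ := fun _ : Fin d => (volume : Measure ℝ)) (i := i)).eventually this
    filter_upwards [hne] with y hy
    by_cases hyA : y ∈ A
    · rw [Set.indicator_of_mem hyA, Real.norm_of_nonneg (Real.rpow_nonneg (sNorm_nonneg _ _) _)]
      have hE : ∀ i, Set.indicator (Set.Icc (-M) M) (fun t : ℝ => |t| ^ (ζ / S)) (y i) =
          |y i| ^ (ζ / S) := fun i =>
        Set.indicator_of_mem (s := Set.Icc (-M) M) (Set.mem_Icc.2 (abs_le.1 (hAM y hyA i))) _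
      simp only [hE]
      have hd : ∃ i : Fin d, True := by
        by_contra h
        push Not at h
        have : S = 0 := Finset.sum_eq_zero fun i _ => (h i).elim
        linarith
      obtain ⟨i0, -⟩ := hd
      have hpos : 0 < sNorm s y := sNorm_pos s (fun h => hy i0 (by simp [h]))
      have : sNorm s y ^ ζ = ∏ i, sNorm s y ^ ((s i : ℝ) * (ζ / S)) := by
        rw [← Real.rpow_sum_of_pos hpos, ← Finset.sum_mul, ← hS]
        congr 1; field_simp
      rw [this]
      refine Finset.prod_le_prod (fun i _ => Real.rpow_nonneg hpos.le _) fun i _ => ?_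
      have hsi : (s i : ℝ) ≠ 0 := by have := hs i; positivity
      have h0 : |y i| ^ (ζ / S) = (|y i| ^ ((s i : ℝ)⁻¹)) ^ ((s i : ℝ) * (ζ / S)) := by
        rw [← Real.rpow_mul (abs_nonneg _)]; congr 1; field_simp
      rw [h0]
      refine Real.rpow_le_rpow_of_nonpos (Real.rpow_pos_of_pos (abs_pos.2 (hy i)) _)
        (le_sNorm s y i) ?_
      exact mul_nonpos_of_nonneg_of_nonpos (by positivity) (div_nonpos_of_nonpos_of_nonneg hζ₂.le hSpos.le)
    · rw [Set.indicator_of_notMem hyA]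
      simp only [norm_zero]
      refine Finset.prod_nonneg fun i _ => Set.indicator_nonneg (fun t _ => by positivity) _

lemma ae_ne_zero {d : ℕ} (hd : 0 < d) : ∀ᵐ y : Fin d → ℝ, y ≠ 0 := by
  have : Nonempty (Fin d) := ⟨⟨0, hd⟩⟩
  have : Nontrivial (Fin d → ℝ) := inferInstance
  rw [ae_iff]; simp

lemma integrable_K {d : ℕ} (s : Fin d → ℕ) (hs : ∀ i, 0 < s i) (ζ : ℝ) (hd : 0 < d)
    (hζ₁ : -(∑ i, (s i : ℝ)) < ζ) (hζ₂ : ζ < 0) (K : (Fin d → ℝ) → ℝ) (N : ℝ)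
    (hK : ContDiffOn ℝ (⊤ : ℕ∞) K {x | x ≠ 0}) (hKc : HasCompactSupport K)
    (hb : ∀ x, x ≠ 0 → |K x| ≤ N * sNorm s x ^ ζ) : Integrable K := by
  have hbd : ∃ M, ∀ y ∈ tsupport K, ‖y‖ ≤ M := hKc.isCompact.isBounded.exists_norm_le
  obtain ⟨M, hM⟩ := hbd
  have hI := integrable_sNorm s hs ζ hζ₁ hζ₂ (tsupport K) M (isClosed_tsupport K).measurableSet
    (fun y hy i => (norm_le_pi_norm y i).trans (hM y hy))
  refine (hI.const_mul N).mono' ?_ ?_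
  · have h1 : AEStronglyMeasurable K (volume.restrict {x | x ≠ 0}) :=
      hK.continuousOn.aestronglyMeasurable isOpen_ne.measurableSet
    rwa [Measure.restrict_eq_self_of_ae_mem (s := {x | x ≠ 0}) (ae_ne_zero hd)] at h1
  · filter_upwards [ae_ne_zero hd] with y hy
    by_cases h : y ∈ tsupport K
    · rw [Set.indicator_of_mem h]; exact hb y hy
    · rw [Set.indicator_of_notMem h, image_eq_zero_of_notMem_tsupport h]; simp
lemma core_far {d : ℕ} (s : Fin d → ℕ) (hs : ∀ i, 0 < s i) (ζ : ℝ) (hd : 0 < d)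
    (hζ₁ : -(∑ i, (s i : ℝ)) < ζ) (hζ₂ : ζ < 0)
    (ρ : (Fin d → ℝ) → ℝ) (hρ : ContDiff ℝ (⊤ : ℕ∞) ρ) (hρc : HasCompactSupport ρ)
    (k : List (Fin d)) (R : ℝ) (hR1 : 1 ≤ R) (hR : ∀ w ∈ tsupport ρ, sNorm s w ≤ R)
    (K : (Fin d → ℝ) → ℝ) (N : ℝ) (hN : 0 ≤ N)
    (hK : ContDiffOn ℝ (⊤ : ℕ∞) K {x | x ≠ 0}) (hKc : HasCompactSupport K)
    (hk : ∀ x, x ≠ 0 → |mderiv k K x| ≤ N * sNorm s x ^ (ζ - (sdeg s k : ℝ)))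
    (x : Fin d → ℝ) (hx : 2 * R < sNorm s x) :
    |mderiv k (fun z => ∫ y, ρ (z - y) * K y) x| ≤
      ((∫ y, |ρ y|) * (3⁻¹ : ℝ) ^ (ζ - (sdeg s k : ℝ))) * N *
        (sNorm s x + 1) ^ (ζ - (sdeg s k : ℝ)) := by
  have hopen : IsOpen {y : Fin d → ℝ | sNorm s y < 1} :=
    isOpen_lt (sNorm_continuous s) continuous_const
  obtain ⟨r, hr, hball⟩ := Metric.isOpen_iff.1 hopen 0 (by simp [sNorm_zero s hs])
  let χ : ContDiffBump (0 : Fin d → ℝ) := ⟨r / 4, r / 2, by positivity, by linarith⟩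
  let G : (Fin d → ℝ) → ℝ := fun y => (1 - χ y) * K y
  have hGK : ∀ y, 1 ≤ sNorm s y → G y = K y := by
    intro y hy
    have : χ y = 0 := by
      apply χ.zero_of_le_dist
      by_contra h
      push Not at h
      have : y ∈ Metric.ball (0 : Fin d → ℝ) r := by
        rw [Metric.mem_ball]
        have : χ.rOut = r / 2 := rfl
        linarith
      have := hball this
      change sNorm s y < 1 at this
      linarith
    simp [G, this]
  have hG : ContDiff ℝ (⊤ : ℕ∞) G := by
    rw [contDiff_iff_contDiffAt]
    intro y
    by_cases hy : y = 0
    · subst hy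
      have : G =ᶠ[nhds 0] fun _ => 0 := by
        filter_upwards [χ.eventuallyEq_one] with y hy
        simp [G, hy]
      exact (contDiffAt_const (c := (0 : ℝ))).congr_of_eventuallyEq this
    · have h1 : ContDiffAt ℝ (⊤ : ℕ∞) K y := hK.contDiffAt (isOpen_ne.mem_nhds hy)
      have h2 : ContDiffAt ℝ (⊤ : ℕ∞) (fun y => 1 - χ y) y :=
        contDiffAt_const.sub χ.contDiff.contDiffAt
      exact h2.mul h1
  have hGc : HasCompactSupport G := hKc.mul_left
  have tri : ∀ a b : Fin d → ℝ, sNorm s a ≤ sNorm s (a - b) + sNorm s b := by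
    intro a b
    have := sNorm_add_le s hs (a - b) b
    simpa using this
  have hloc : (fun z => ∫ y, ρ (z - y) * K y) =ᶠ[nhds x] fun z => ∫ y, G (z - y) * ρ y := by
    have ho : IsOpen {y : Fin d → ℝ | 2 * R < sNorm s y} :=
      isOpen_lt continuous_const (sNorm_continuous s)
    filter_upwards [ho.mem_nhds hx] with z hz
    rw [conv_comm G ρ z]
    congr 1
    funext y
    by_cases h : z - y ∈ tsupport ρ
    · have h1 := hR _ h
      have h2 := tri z y
      change 2 * R < sNorm s z at hz
      rw [hGK y (by linarith)]
    · rw [image_eq_zero_of_notMem_tsupport h]; simp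
  rw [(mderiv_congr k hloc).eq_of_nhds,
    mderiv_conv k hG hGc (hρ.continuous.integrable_of_hasCompactSupport hρc).locallyIntegrable]
  have hneg : ζ - (sdeg s k : ℝ) ≤ 0 := by
    have : (0 : ℝ) ≤ sdeg s k := by positivity
    linarith
  have hxn := sNorm_nonneg s x
  set c : ℝ := N * ((3⁻¹ : ℝ) ^ (ζ - (sdeg s k : ℝ)) * (sNorm s x + 1) ^ (ζ - (sdeg s k : ℝ)))
    with hc
  have hρi : Integrable (fun y => |ρ y|) :=
    (hρ.continuous.integrable_of_hasCompactSupport hρc).abs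
  have := norm_integral_le_of_norm_le (f := fun y => mderiv k G (x - y) * ρ y)
    (hρi.const_mul c) (Filter.Eventually.of_forall ?_)
  · rw [integral_const_mul] at this
    rw [Real.norm_eq_abs] at this
    refine this.trans (le_of_eq ?_)
    rw [hc]; ring
  · intro y
    rw [Real.norm_eq_abs, abs_mul]
    by_cases h : y ∈ tsupport ρ
    · refine mul_le_mul_of_nonneg_right ?_ (abs_nonneg _)
      have h1 := hR _ h
      have h2 := tri x y
      have h3 : R < sNorm s (x - y) := by linarith
      have ho : IsOpen {y : Fin d → ℝ | 1 < sNorm s y} :=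
        isOpen_lt continuous_const (sNorm_continuous s)
      have hl : G =ᶠ[nhds (x - y)] K := by
        filter_upwards [ho.mem_nhds (show 1 < sNorm s (x - y) by linarith)] with z hz
        exact hGK z (le_of_lt hz)
      rw [(mderiv_congr k hl).eq_of_nhds]
      have hne : x - y ≠ 0 := by
        intro h0
        rw [h0, sNorm_zero s hs] at h3
        linarith
      refine (hk _ hne).trans ?_
      rw [hc, ← Real.mul_rpow (by norm_num) (by linarith)]
      refine mul_le_mul_of_nonneg_left ?_ hN
      refine Real.rpow_le_rpow_of_nonpos (by positivity) ?_ hneg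
      linarith
    · rw [image_eq_zero_of_notMem_tsupport h]; simp

lemma core_near {d : ℕ} (s : Fin d → ℕ) (hs : ∀ i, 0 < s i) (ζ : ℝ) (hd : 0 < d)
    (hζ₁ : -(∑ i, (s i : ℝ)) < ζ) (hζ₂ : ζ < 0)
    (ρ : (Fin d → ℝ) → ℝ) (hρ : ContDiff ℝ (⊤ : ℕ∞) ρ) (hρc : HasCompactSupport ρ)
    (k : List (Fin d)) (R : ℝ) (hR1 : 1 ≤ R) (hR : ∀ w ∈ tsupport ρ, sNorm s w ≤ R)
    (B : ℝ) (hB : ∀ w, |mderiv k ρ w| ≤ B)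
    (K : (Fin d → ℝ) → ℝ) (N : ℝ) (hN : 0 ≤ N)
    (hK : ContDiffOn ℝ (⊤ : ℕ∞) K {x | x ≠ 0}) (hKc : HasCompactSupport K)
    (hb : ∀ x, x ≠ 0 → |K x| ≤ N * sNorm s x ^ ζ)
    (x : Fin d → ℝ) (hx : sNorm s x ≤ 2 * R) :
    |mderiv k (fun z => ∫ y, ρ (z - y) * K y) x| ≤
      (B * (∫ y, Set.indicator {y | sNorm s y ≤ 3 * R} (fun y => sNorm s y ^ ζ) y) *
        ((2 * R + 1) ^ (ζ - (sdeg s k : ℝ)))⁻¹) * N *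
        (sNorm s x + 1) ^ (ζ - (sdeg s k : ℝ)) := by
  have hKi := integrable_K s hs ζ hd hζ₁ hζ₂ K N hK hKc hb
  rw [mderiv_conv k hρ hρc hKi.locallyIntegrable]
  have hxn := sNorm_nonneg s x
  have hB0 : 0 ≤ B := (abs_nonneg _).trans (hB 0)
  have hneg : ζ - (sdeg s k : ℝ) ≤ 0 := by
    have : (0 : ℝ) ≤ sdeg s k := by positivity
    linarith
  have hSm : MeasurableSet {y : Fin d → ℝ | sNorm s y ≤ 3 * R} :=
    (isClosed_le (sNorm_continuous s) continuous_const).measurableSet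
  have hI : Integrable (Set.indicator {y | sNorm s y ≤ 3 * R} (fun y => sNorm s y ^ ζ)) := by
    refine integrable_sNorm s hs ζ hζ₁ hζ₂ _ (∑ i, (3 * R) ^ (s i)) hSm ?_
    intro y hy i
    have h1 : |y i| ^ ((s i : ℝ)⁻¹) ≤ 3 * R := (le_sNorm s y i).trans hy
    have h2 : |y i| ≤ (3 * R) ^ (s i) := by
      calc |y i| = (|y i| ^ ((s i : ℝ)⁻¹)) ^ (s i) :=
            (Real.rpow_inv_natCast_pow (abs_nonneg _) (hs i).ne').symm
        _ ≤ _ := pow_le_pow_left₀ (by positivity) h1 _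
    refine h2.trans ?_
    exact Finset.single_le_sum (f := fun i => (3 * R) ^ (s i)) (fun i _ => by positivity)
      (Finset.mem_univ i)
  have := norm_integral_le_of_norm_le (f := fun y => mderiv k ρ (x - y) * K y)
    (hI.const_mul (B * N)) ?_
  · rw [integral_const_mul, Real.norm_eq_abs] at this
    refine this.trans ?_
    set I := ∫ y, Set.indicator {y | sNorm s y ≤ 3 * R} (fun y => sNorm s y ^ ζ) y with hIdef
    have hI0 : 0 ≤ I := integral_nonneg fun y =>
      Set.indicator_nonneg (fun y _ => Real.rpow_nonneg (sNorm_nonneg s y) _) y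
    have hp : 0 < (2 * R + 1) ^ (ζ - (sdeg s k : ℝ)) := Real.rpow_pos_of_pos (by linarith) _
    have hle : (2 * R + 1) ^ (ζ - (sdeg s k : ℝ)) ≤ (sNorm s x + 1) ^ (ζ - (sdeg s k : ℝ)) :=
      Real.rpow_le_rpow_of_nonpos (by linarith) (by linarith) hneg
    calc B * N * I = B * N * I * 1 := by ring
      _ ≤ B * N * I * (((2 * R + 1) ^ (ζ - (sdeg s k : ℝ)))⁻¹ *
            (sNorm s x + 1) ^ (ζ - (sdeg s k : ℝ))) := by
          refine mul_le_mul_of_nonneg_left ?_ (by positivity)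
          rw [inv_mul_eq_div, one_le_div hp]
          exact hle
      _ = _ := by ring
  · filter_upwards [ae_ne_zero hd] with y hy
    rw [Real.norm_eq_abs, abs_mul]
    by_cases h : x - y ∈ tsupport ρ
    · have h1 := hR _ h
      have h2 : sNorm s y ≤ 3 * R := by
        have h3 := sNorm_add_le s hs x (-(x - y))
        have h4 : sNorm s (-(x - y)) = sNorm s (x - y) := by simp only [sNorm, Pi.neg_apply, abs_neg]
        have h5 : x + -(x - y) = y := by abel
        rw [h5, h4] at h3
        linarith
      rw [Set.indicator_of_mem (show y ∈ {y | sNorm s y ≤ 3 * R} from h2), mul_assoc]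
      exact mul_le_mul (hB _) (hb y hy) (abs_nonneg _) hB0
    · have : x - y ∉ tsupport (mderiv k ρ) := fun h' => h (mderiv_tsupport k ρ h')
      rw [image_eq_zero_of_notMem_tsupport this]
      simp only [abs_zero, zero_mul]
      refine mul_nonneg (by positivity) ?_
      exact Set.indicator_nonneg (fun y _ => Real.rpow_nonneg (sNorm_nonneg s y) _) y

lemma core {d : ℕ} (s : Fin d → ℕ) (hs : ∀ i, 0 < s i) (ζ : ℝ) (hd : 0 < d)
    (hζ₁ : -(∑ i, (s i : ℝ)) < ζ) (hζ₂ : ζ < 0)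
    (ρ : (Fin d → ℝ) → ℝ) (hρ : ContDiff ℝ (⊤ : ℕ∞) ρ) (hρc : HasCompactSupport ρ)
    (k : List (Fin d)) :
    ∃ C : ℝ, ∀ (K : (Fin d → ℝ) → ℝ) (N : ℝ), 0 ≤ N →
      ContDiffOn ℝ (⊤ : ℕ∞) K {x | x ≠ 0} → HasCompactSupport K →
      (∀ x, x ≠ 0 → |K x| ≤ N * sNorm s x ^ ζ) →
      (∀ x, x ≠ 0 → |mderiv k K x| ≤ N * sNorm s x ^ (ζ - (sdeg s k : ℝ))) →
      ∀ x, |mderiv k (fun z => ∫ y, ρ (z - y) * K y) x| ≤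
        C * N * (sNorm s x + 1) ^ (ζ - (sdeg s k : ℝ)) := by
  obtain ⟨R0, hR0⟩ := hρc.isCompact.bddAbove_image (sNorm_continuous s).continuousOn
  have hR : ∀ w ∈ tsupport ρ, sNorm s w ≤ max R0 1 := fun w hw =>
    (hR0 (Set.mem_image_of_mem _ hw)).trans (le_max_left _ _)
  obtain ⟨B, hB⟩ := (mderiv_contDiff k hρ).continuous.bounded_above_of_compact_support
    (mderiv_compactSupport k hρc)
  refine ⟨max ((∫ y, |ρ y|) * (3⁻¹ : ℝ) ^ (ζ - (sdeg s k : ℝ)))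
    (B * (∫ y, Set.indicator {y | sNorm s y ≤ 3 * (max R0 1)} (fun y => sNorm s y ^ ζ) y) *
        ((2 * (max R0 1) + 1) ^ (ζ - (sdeg s k : ℝ)))⁻¹), ?_⟩
  intro K N hN hK hKc hb hk x
  have hxn := sNorm_nonneg s x
  rcases lt_or_ge (2 * max R0 1) (sNorm s x) with hx | hx
  · refine (core_far s hs ζ hd hζ₁ hζ₂ ρ hρ hρc k _ (le_max_right _ _) hR K N hN hK hKc hk x
      hx).trans ?_
    gcongr
    exact le_max_left _ _
  · refine (core_near s hs ζ hd hζ₁ hζ₂ ρ hρ hρc k _ (le_max_right _ _) hR B hB K N hN hK hKc hb x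
      hx).trans ?_
    gcongr
    exact le_max_right _ _

lemma list_prod_pow {d : ℕ} (s : Fin d → ℕ) (ε : ℝ) (l : List (Fin d)) :
    (l.map (fun i => ε ^ (s i))).prod = ε ^ (sdeg s l) := by
  induction l with
  | nil => simp [sdeg]
  | cons i l ih => simp only [List.map_cons, List.prod_cons, ih, sdeg, List.sum_cons, pow_add]

/-- First part of Lemma 10.17: let `K` be of order `ζ ∈ (-|s|, 0)`, let `ρ` be a smooth
compactly supported mollifier with `∫ ρ = 1`, and let
`K_ε = K * ρ_ε` with `ρ_ε(y) = ε^{-|s|} ρ(S_s^ε y)`. Then for every multiindex `k` (a list of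
coordinate directions) there is a constant `C` such that
`|D^k K_ε(x)| ≤ C ⦀K⦀_{ζ;|k|_s} (‖x‖_s + ε)^{ζ - |k|_s}`, uniformly over `ε ∈ (0,1]` and `x`. -/
theorem stmt_9 {d : ℕ} (s : Fin d → ℕ) (hs : ∀ i, 0 < s i) (ζ : ℝ)
    (hζ₁ : -(∑ i, (s i : ℝ)) < ζ) (hζ₂ : ζ < 0)
    (ρ : (Fin d → ℝ) → ℝ) (hρ : ContDiff ℝ (⊤ : ℕ∞) ρ) (hρc : HasCompactSupport ρ)
    (hρ1 : (∫ y, ρ y) = 1) (k : List (Fin d)) :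
    ∃ C : ℝ, ∀ (K : (Fin d → ℝ) → ℝ) (N : ℝ),
      ContDiffOn ℝ (⊤ : ℕ∞) K {x | x ≠ 0} → HasCompactSupport K →
      (∀ ℓ : List (Fin d), sdeg s ℓ ≤ sdeg s k → ∀ x : Fin d → ℝ, x ≠ 0 →
        |mderiv ℓ K x| ≤ N * sNorm s x ^ (ζ - (sdeg s ℓ : ℝ))) →
      ∀ ε : ℝ, 0 < ε → ε ≤ 1 → ∀ x : Fin d → ℝ,
        |mderiv k
            (fun z => ∫ y, (ε ^ (∑ i, s i) : ℝ)⁻¹ * ρ (fun i => (z i - y i) / ε ^ (s i)) * K y)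
            x|
          ≤ C * N * (sNorm s x + ε) ^ (ζ - (sdeg s k : ℝ)) := by
  have hd : 0 < d := by
    rcases Nat.eq_zero_or_pos d with h | h
    · subst h
      simp at hζ₁
      linarith
    · exact h
  obtain ⟨C, hC⟩ := core s hs ζ hd hζ₁ hζ₂ ρ hρ hρc k
  refine ⟨C, ?_⟩
  intro K N hK hKc hb ε hε hε1 x
  have hb0 : ∀ x, x ≠ 0 → |K x| ≤ N * sNorm s x ^ ζ := by
    intro x hx
    simpa [sdeg, mderiv] using hb [] (by simp [sdeg]) x hx
  have hN : 0 ≤ N := by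
    have h1 : (fun _ : Fin d => (1 : ℝ)) ≠ 0 := by
      intro h
      have := congrFun h ⟨0, hd⟩
      simp at this
    have h2 := (abs_nonneg _).trans (hb0 _ h1)
    exact nonneg_of_mul_nonneg_left h2 (Real.rpow_pos_of_pos (sNorm_pos s h1) _)
  have hεs : ∀ i, 0 < ε ^ (s i) := fun i => pow_pos hε _
  -- the rescaled kernel
  let K' : (Fin d → ℝ) → ℝ := fun w => K (fun i => ε ^ (s i) * w i)
  let e : (Fin d → ℝ) ≃L[ℝ] (Fin d → ℝ) := ContinuousLinearEquiv.piCongrRight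
      (fun i => ContinuousLinearEquiv.unitsEquivAut ℝ (Units.mk0 (ε ^ (s i)) (hεs i).ne'))
  have he : ∀ z, e z = fun i => ε ^ (s i) * z i := by
    intro z; funext i; simp [e, mul_comm]
  have hne : ∀ w : Fin d → ℝ, w ≠ 0 → (fun i => ε ^ (s i) * w i) ≠ 0 := by
    intro w hw
    rw [← he]
    simpa using hw
  have hK'e : K' = K ∘ e := by
    funext w; simp [K', he]
  have hK' : ContDiffOn ℝ (⊤ : ℕ∞) K' {x | x ≠ 0} := by
    rw [hK'e]
    refine hK.comp e.contDiff.contDiffOn ?_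
    intro w hw
    simpa using hw
  have hK'c : HasCompactSupport K' := by
    rw [hK'e]
    exact hKc.comp_homeomorph e.toHomeomorph
  have hbd : ∀ l : List (Fin d), sdeg s l ≤ sdeg s k → ∀ x : Fin d → ℝ, x ≠ 0 →
        |mderiv l K' x| ≤ (N * ε ^ ζ) * sNorm s x ^ (ζ - (sdeg s l : ℝ)) := by
    intro l hl w hw
    have h1 := hb l hl _ (hne w hw)
    rw [sNorm_scale s hs ε hε, Real.mul_rpow hε.le (sNorm_nonneg s w)] at h1
    have h2 : mderiv l K' w = ε ^ (sdeg s l) * mderiv l K (fun i => ε ^ (s i) * w i) := by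
      have := congrFun (mderiv_scale l K (fun i => ε ^ (s i)) (fun i => (hεs i).ne')) w
      rw [list_prod_pow] at this
      exact this
    rw [h2, abs_mul, abs_of_pos (pow_pos hε _)]
    refine (mul_le_mul_of_nonneg_left h1 (pow_pos hε _).le).trans (le_of_eq ?_)
    rw [Real.rpow_sub hε, Real.rpow_natCast]
    have := (pow_pos hε (sdeg s l)).ne'
    field_simp
  have hmain := hC K' (N * ε ^ ζ) (by positivity) hK' hK'c
    (by
      intro x hx
      simpa [sdeg, mderiv] using hbd [] (by simp [sdeg]) x hx)
    (hbd k le_rfl) (fun i => (ε ^ (s i))⁻¹ * x i)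
  have hfun : (fun z : Fin d → ℝ => ∫ y : Fin d → ℝ,
      (ε ^ (∑ i, s i) : ℝ)⁻¹ * ρ (fun i => (z i - y i) / ε ^ (s i)) * K y) =
      fun z => (fun u => ∫ w, ρ (u - w) * K' w) (fun i => (ε ^ (s i))⁻¹ * z i) := by
    funext z
    rw [integral_scale _ (fun i => ε ^ (s i)) hεs, Finset.prod_pow_eq_pow_sum,
      ← integral_const_mul]
    congr 1
    funext y
    have h0 := (pow_pos hε (∑ i, s i)).ne'
    have h1 : (fun i => (z i - ε ^ (s i) * y i) / ε ^ (s i)) =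
        (fun i => (ε ^ (s i))⁻¹ * z i) - y := by
      funext i
      have := (hεs i).ne'
      simp only [Pi.sub_apply]
      field_simp
    rw [h1]
    simp only [K']
    field_simp
  rw [hfun, mderiv_scale k (fun u => ∫ w, ρ (u - w) * K' w) (fun i => (ε ^ (s i))⁻¹) (fun i => (inv_pos.2 (hεs i)).ne')]
  have hprod : (k.map (fun i => (ε ^ (s i))⁻¹)).prod = (ε ^ (sdeg s k))⁻¹ := by
    have := list_prod_pow s ε⁻¹ k
    simpa [inv_pow] using this
  simp only [hprod]
  rw [abs_mul, abs_of_pos (inv_pos.2 (pow_pos hε _))]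
  refine (mul_le_mul_of_nonneg_left hmain (inv_pos.2 (pow_pos hε _)).le).trans (le_of_eq ?_)
  have hx1 : sNorm s x = ε * sNorm s (fun i => (ε ^ (s i))⁻¹ * x i) := by
    rw [← sNorm_scale s hs ε hε]
    congr 1
    funext i
    have := (hεs i).ne'
    field_simp
  have hn := sNorm_nonneg s (fun i => (ε ^ (s i))⁻¹ * x i)
  have hx2 : sNorm s x + ε = ε * (sNorm s (fun i => (ε ^ (s i))⁻¹ * x i) + 1) := by
    rw [hx1]; ring
  rw [hx2, Real.mul_rpow hε.le (by linarith), Real.rpow_sub hε, Real.rpow_natCast]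
  ring
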